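/- arXiv:2312.12375 — 4 statements merged into one kernel-verified Lean document; each statement's English description precedes it below -/
import Mathlib

section
/- Let C ⊆ ℝⁿ be a closed set and H ⊆ ℝⁿ an affine hyperplane such that some connected component B of ℝⁿ \ (C ∪ H) is bounded (so C is a local cone with local cone region B). If f : ℝᵐ → ℝⁿ is a non-constant proper harmonic map and f(p₀) ∈ B for some p₀ ∈ ℝᵐ, then there exists q ∈ ℝᵐ with f(q) ∈ C. In other words, a proper harmonic map entering B must leave through C. -/
open Metric

/-- A map `f : ℝᵐ → ℝⁿ` is harmonic if it is `C²` and its Laplacian vanishes. -/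
def IsHarmonicMap {m n : ℕ}
    (f : EuclideanSpace ℝ (Fin m) → EuclideanSpace ℝ (Fin n)) : Prop :=
  ContDiff ℝ 2 f ∧ ∀ x, ∑ i : Fin m,
    fderiv ℝ (fun y => fderiv ℝ f y (EuclideanSpace.single i 1)) x
      (EuclideanSpace.single i 1) = 0

open scoped Topology in
theorem not_isLocalMax_of_deriv_deriv_pos {g : ℝ → ℝ} {x : ℝ} (hg : ContinuousAt g x)
    (h : 0 < deriv (deriv g) x) : ¬ IsLocalMax g x := by
  intro hmax
  have hmin := isLocalMin_of_deriv_deriv_pos h hmax.deriv_eq_zero hg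
  have hconst : g =ᶠ[𝓝 x] fun _ => g x := by
    filter_upwards [hmax, hmin] with y h₁ h₂ using le_antisymm h₁ h₂
  have hzero : deriv (deriv g) x = 0 := by
    rw [hconst.deriv.deriv_eq]
    simp
  exact h.ne' hzero

theorem hasDerivAt_comp_line {E F : Type*} [NormedAddCommGroup E] [NormedSpace ℝ E]
    [NormedAddCommGroup F] [NormedSpace ℝ F] {u : E → F} (hu : Differentiable ℝ u)
    (x v : E) (t : ℝ) :
    HasDerivAt (fun s : ℝ => u (x + s • v)) (fderiv ℝ u (x + t • v) v) t := by
  have hline : HasDerivAt (fun s : ℝ => x + s • v) v t := by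
    simpa using ((hasDerivAt_id t).smul_const v).const_add x
  exact (hu _).hasFDerivAt.comp_hasDerivAt t hline

theorem ContDiff.differentiable_fderiv_apply_const {E F : Type*} [NormedAddCommGroup E]
    [NormedSpace ℝ E] [NormedAddCommGroup F] [NormedSpace ℝ F] {u : E → F}
    (hu : ContDiff ℝ 2 u) (v : E) : Differentiable ℝ fun y => fderiv ℝ u y v :=
  ((hu.fderiv_right (m := 1) (by norm_num)).clm_apply contDiff_const).differentiable
    (by norm_num)

theorem deriv_deriv_comp_line {E F : Type*} [NormedAddCommGroup E] [NormedSpace ℝ E]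
    [NormedAddCommGroup F] [NormedSpace ℝ F] {u : E → F} (hu : ContDiff ℝ 2 u) (x v : E) :
    deriv (deriv fun s : ℝ => u (x + s • v)) 0 =
      fderiv ℝ (fun y => fderiv ℝ u y v) x v := by
  have hderiv : (deriv fun s : ℝ => u (x + s • v)) = fun s => fderiv ℝ u (x + s • v) v :=
    funext fun t => (hasDerivAt_comp_line (hu.differentiable (by norm_num)) x v t).deriv
  rw [hderiv]
  simpa using (hasDerivAt_comp_line (hu.differentiable_fderiv_apply_const v) x v 0).deriv

theorem fderiv_fderiv_norm_sq {E : Type*} [NormedAddCommGroup E] [InnerProductSpace ℝ E]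
    (x v : E) :
    fderiv ℝ (fun y => fderiv ℝ (fun z : E => ‖z‖ ^ 2) y v) x v = 2 * ‖v‖ ^ 2 := by
  have hfirst : (fun y => fderiv ℝ (fun z : E => ‖z‖ ^ 2) y v) =
      fun y => ((2 : ℝ) • innerSL ℝ v) y := by
    ext y
    simp [fderiv_norm_sq_apply, real_inner_comm]
  rw [hfirst, ContinuousLinearMap.fderiv]
  simp

/-- **Weak maximum principle**: a harmonic function on a bounded open set is bounded above by
its supremum on the boundary. -/
theorem le_of_laplacian_eq_zero_of_frontier_le {ι : Type*} [Fintype ι] [Nonempty ι]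
    [DecidableEq ι] {u : EuclideanSpace ℝ ι → ℝ} (hu : ContDiff ℝ 2 u)
    (hlap : ∀ x, ∑ i, fderiv ℝ (fun y => fderiv ℝ u y (EuclideanSpace.single i 1)) x
      (EuclideanSpace.single i 1) = 0)
    {W : Set (EuclideanSpace ℝ ι)} (hW : IsOpen W) (hWb : Bornology.IsBounded W) {c : ℝ}
    (hfr : ∀ x ∈ frontier W, u x ≤ c) {p : EuclideanSpace ℝ ι} (hp : p ∈ W) : u p ≤ c := by
  by_contra! hlt
  obtain ⟨R, hRpos, hR⟩ := hWb.closure.exists_pos_norm_le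
  obtain ⟨ε, hε, hεR⟩ : ∃ ε : ℝ, 0 < ε ∧ ε * R ^ 2 < u p - c := by
    refine ⟨(u p - c) / (2 * R ^ 2), by have := sub_pos.2 hlt; positivity, ?_⟩
    have : (u p - c) / (2 * R ^ 2) * R ^ 2 = (u p - c) / 2 := by field_simp
    linarith
  set v : EuclideanSpace ℝ ι → ℝ := fun x => u x + ε * ‖x‖ ^ 2 with hv
  have hsq : ContDiff ℝ 2 fun x : EuclideanSpace ℝ ι => ‖x‖ ^ 2 := contDiff_norm_sq ℝ
  have hvC : ContDiff ℝ 2 v := hu.add (contDiff_const.mul hsq)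
  obtain ⟨x, hxK, hxmax⟩ := hWb.isCompact_closure.exists_isMaxOn ⟨p, subset_closure hp⟩
    hvC.continuous.continuousOn
  have hpx : v p ≤ v x := hxmax (subset_closure hp)
  have hxW : x ∈ W := by
    by_contra hxW
    have hux := hfr x (by rw [hW.frontier_eq]; exact ⟨hxK, hxW⟩)
    have hnorm : ‖x‖ ^ 2 ≤ R ^ 2 := by gcongr; exact hR x hxK
    have : 0 ≤ ε * ‖p‖ ^ 2 := by positivity
    have : ε * ‖x‖ ^ 2 ≤ ε * R ^ 2 := by gcongr
    simp only [hv] at hpx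
    linarith
  obtain ⟨i, -, hi⟩ : ∃ i ∈ Finset.univ,
      0 ≤ fderiv ℝ (fun y => fderiv ℝ u y (EuclideanSpace.single i 1)) x
        (EuclideanSpace.single i 1) := by
    apply Finset.exists_le_of_sum_le Finset.univ_nonempty
    simp [hlap x]
  set e : EuclideanSpace ℝ ι := EuclideanSpace.single i 1 with he
  have hline : Continuous fun t : ℝ => x + t • e := by fun_prop
  have hlocal : IsLocalMax (fun t : ℝ => v (x + t • e)) 0 := by
    have hmem : ∀ᶠ t : ℝ in nhds 0, x + t • e ∈ W :=
      hline.continuousAt.eventually_mem (hW.mem_nhds (by simpa using hxW))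
    filter_upwards [hmem] with t ht
    simpa using hxmax (subset_closure ht)
  refine not_isLocalMax_of_deriv_deriv_pos (hvC.continuous.comp hline).continuousAt ?_ hlocal
  have hdu := hu.differentiable_fderiv_apply_const e x
  have hdsq := hsq.differentiable_fderiv_apply_const e x
  have hfirst : (fun y => fderiv ℝ v y e) =
      fun y => fderiv ℝ u y e + ε * fderiv ℝ (fun z => ‖z‖ ^ 2) y e := by
    ext y
    have hud := hu.differentiable (by norm_num) y
    have hsqd := hsq.differentiable (by norm_num) y
    rw [hv, fderiv_fun_add hud (hsqd.const_mul ε), fderiv_const_mul hsqd]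
    rfl
  have hsecond : fderiv ℝ (fun y => fderiv ℝ v y e) x e =
      fderiv ℝ (fun y => fderiv ℝ u y e) x e + ε * 2 := by
    rw [hfirst, fderiv_fun_add hdu (hdsq.const_mul ε),
      fderiv_const_mul hdsq]
    rw [add_apply, smul_apply, fderiv_fderiv_norm_sq]
    simp [he]
  have hpos : 0 < fderiv ℝ (fun y => fderiv ℝ v y e) x e := by
    rw [hsecond]
    positivity
  exact hpos.trans_eq (deriv_deriv_comp_line hvC x e).symm

theorem IsHarmonicMap.laplacian_clm_comp {m n : ℕ}
    {f : EuclideanSpace ℝ (Fin m) → EuclideanSpace ℝ (Fin n)} (hf : IsHarmonicMap f)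
    (φ : EuclideanSpace ℝ (Fin n) →L[ℝ] ℝ) (x : EuclideanSpace ℝ (Fin m)) :
    ∑ i, fderiv ℝ (fun y => fderiv ℝ (fun z => φ (f z)) y (EuclideanSpace.single i 1)) x
      (EuclideanSpace.single i 1) = 0 := by
  rw [← map_zero φ, ← hf.2 x, map_sum]
  refine Finset.sum_congr rfl fun i _ => ?_
  have hfirst : (fun y => fderiv ℝ (fun z => φ (f z)) y (EuclideanSpace.single i 1)) =
      fun y => φ (fderiv ℝ f y (EuclideanSpace.single i 1)) := by
    ext y
    exact DFunLike.congr_fun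
      (φ.hasFDerivAt.comp y (hf.1.differentiable (by norm_num) y).hasFDerivAt).fderiv _
  have hdir := hf.1.differentiable_fderiv_apply_const (EuclideanSpace.single i 1) x
  rw [hfirst]
  exact DFunLike.congr_fun (φ.hasFDerivAt.comp x hdir.hasFDerivAt).fderiv _

theorem frontier_connectedComponentIn_subset_compl {X : Type*} [TopologicalSpace X]
    [LocallyConnectedSpace X] {U : Set X} (hU : IsOpen U) (x : X) :
    frontier (connectedComponentIn U x) ⊆ Uᶜ := by
  intro y hy hyU
  rw [hU.connectedComponentIn.frontier_eq] at hy
  obtain ⟨z, hzy, hzx⟩ := mem_closure_iff.1 hy.1 _ hU.connectedComponentIn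
    (mem_connectedComponentIn hyU)
  apply hy.2
  rw [connectedComponentIn_eq hzx, ← connectedComponentIn_eq hzy]
  exact mem_connectedComponentIn hyU

/-- **Local cone theorem** (Euclidean domain): if `C` is a closed set, `H = {x | φ x = c}`
an affine hyperplane, and `B` a bounded connected component of `ℝⁿ \ (C ∪ H)`, then a
non-constant proper harmonic map whose image meets `B` must also hit `C`. -/
theorem local_cone_theorem {m n : ℕ}
    (C : Set (EuclideanSpace ℝ (Fin n))) (hC : IsClosed C)
    (φ : EuclideanSpace ℝ (Fin n) →L[ℝ] ℝ) (c : ℝ) (hφ : φ ≠ 0)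
    (B : Set (EuclideanSpace ℝ (Fin n)))
    (hB_comp : ∃ b₀ ∈ (C ∪ {x | φ x = c})ᶜ,
      B = connectedComponentIn (C ∪ {x | φ x = c})ᶜ b₀)
    (hB_bdd : Bornology.IsBounded B)
    (f : EuclideanSpace ℝ (Fin m) → EuclideanSpace ℝ (Fin n))
    (hf : IsHarmonicMap f) (hproper : IsProperMap f)
    (hnonconst : ¬ ∃ v, ∀ x, f x = v)
    (p₀ : EuclideanSpace ℝ (Fin m)) (hp₀ : f p₀ ∈ B) :
    ∃ q, f q ∈ C := by
  by_contra! hno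
  have : Nonempty (Fin m) := by
    by_contra hm
    rw [not_nonempty_iff] at hm
    exact hnonconst ⟨f p₀, fun x => congrArg f (Subsingleton.elim x p₀)⟩
  obtain ⟨b₀, -, rfl⟩ := hB_comp
  set U : Set (EuclideanSpace ℝ (Fin n)) := (C ∪ {x | φ x = c})ᶜ with hU
  have hUo : IsOpen U :=
    (hC.union (isClosed_eq φ.continuous continuous_const)).isOpen_compl
  have hBo : IsOpen (connectedComponentIn U b₀) := hUo.connectedComponentIn
  have hW := hBo.preimage hproper.continuous
  have hWb : Bornology.IsBounded (f ⁻¹' connectedComponentIn U b₀) :=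
    (hproper.isCompact_preimage hB_bdd.isCompact_closure).isBounded.subset
      (Set.preimage_mono subset_closure)
  have hfr : ∀ x ∈ frontier (f ⁻¹' connectedComponentIn U b₀), φ (f x) = c := by
    intro x hx
    have hxU := frontier_connectedComponentIn_subset_compl hUo b₀
      (hproper.continuous.frontier_preimage_subset _ hx)
    rw [hU, compl_compl] at hxU
    exact hxU.resolve_left (hno x)
  have hle := le_of_laplacian_eq_zero_of_frontier_le (φ.contDiff.comp hf.1)
    (hf.laplacian_clm_comp φ) hW hWb (fun x hx => (hfr x hx).le) hp₀
  have hge := le_of_laplacian_eq_zero_of_frontier_le ((-φ).contDiff.comp hf.1)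
    (hf.laplacian_clm_comp (-φ)) hW hWb (c := -c) (fun x hx => (neg_inj.2 (hfr x hx)).le) hp₀
  exact connectedComponentIn_subset U b₀ hp₀ (Or.inr (le_antisymm hle (neg_le_neg_iff.1 hge)))
end

section
/- Let N be a metric space and γ : [0,∞) → N a unit-speed minimizing geodesic ray, i.e. dist(γ(s), γ(t)) = |s − t| for all s, t ≥ 0. Let r : [0,∞) → [0,∞) be continuously differentiable with r(0) = 0 and r(t) < t for all t > 0, and fix 0 ≤ a < b. Then the following are equivalent: (i) r′(t) ≥ 1 for all t ∈ (a,b); (ii) for all t₁, t₂ with a < t₁ < t₂ < b, the closed ball of radius r(t₁) about γ(t₁) is contained in the closed ball of radius r(t₂) about γ(t₂). -/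
open Metric Set

/-- On an open interval, a differentiable function has derivative at least `1` if and only if
subtracting the identity from it leaves a monotone function. -/
lemma one_le_deriv_iff_monotoneOn_sub_id {r : ℝ → ℝ} (hr : Differentiable ℝ r) (a b : ℝ) :
    (∀ t ∈ Ioo a b, 1 ≤ deriv r t) ↔ MonotoneOn (fun t => r t - t) (Ioo a b) := by
  have hderiv (t : ℝ) : HasDerivAt (fun t => r t - t) (deriv r t - 1) t :=
    (hr t).hasDerivAt.sub (hasDerivAt_id t)
  constructor
  · intro h
    refine monotoneOn_of_deriv_nonneg (convex_Ioo a b)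
      (fun t _ => (hderiv t).continuousAt.continuousWithinAt)
      (fun t _ => (hderiv t).differentiableAt.differentiableWithinAt) fun t ht => ?_
    rw [interior_Ioo] at ht
    rw [(hderiv t).deriv]
    exact sub_nonneg.2 (h t ht)
  · intro h t ht
    have hnonneg := h.derivWithin_nonneg (x := t)
    rw [derivWithin_of_isOpen isOpen_Ioo ht, (hderiv t).deriv] at hnonneg
    exact sub_nonneg.1 hnonneg

/-- Along a minimizing geodesic ray, a ball that does not reach past the origin of the ray lies in
a later one if and only if the difference of the radii is at least the distance of the centers. -/
lemma closedBall_subset_closedBall_iff_of_ray {N : Type*} [PseudoMetricSpace N] {γ : ℝ → N}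
    (hγ : ∀ s t : ℝ, 0 ≤ s → 0 ≤ t → dist (γ s) (γ t) = |s - t|) {t₁ t₂ r₁ r₂ : ℝ}
    (hr₁ : 0 ≤ r₁) (hrt : r₁ ≤ t₁) (ht : t₁ ≤ t₂) :
    closedBall (γ t₁) r₁ ⊆ closedBall (γ t₂) r₂ ↔ r₁ - t₁ ≤ r₂ - t₂ := by
  have hs : 0 ≤ t₁ - r₁ := sub_nonneg.2 hrt
  have ht₁ : 0 ≤ t₁ := hr₁.trans hrt
  constructor
  · intro h
    have hmem : γ (t₁ - r₁) ∈ closedBall (γ t₁) r₁ := by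
      rw [mem_closedBall, hγ _ _ hs ht₁, abs_le]
      constructor <;> linarith
    have hdist := mem_closedBall.1 (h hmem)
    rw [hγ _ _ hs (ht₁.trans ht), abs_le] at hdist
    linarith [hdist.1]
  · intro h
    refine closedBall_subset_closedBall' ?_
    rw [hγ _ _ ht₁ (ht₁.trans ht), abs_sub_comm, abs_of_nonneg (sub_nonneg.2 ht)]
    linarith

/-- Nested geodesic balls along a minimizing geodesic ray: for a unit-speed minimizing
geodesic ray `γ` in a metric space `N` and a `C¹` cone radius function `r` with
`r 0 = 0` and `r t < t` for `t > 0`, the condition `r' ≥ 1` on `(a,b)` is equivalent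
to the closed balls `closedBall (γ t) (r t)` being nested for `a < t₁ < t₂ < b`. -/
theorem nested_balls_iff_deriv_ge_one {N : Type*} [MetricSpace N]
    (γ : ℝ → N) (hγ : ∀ s t : ℝ, 0 ≤ s → 0 ≤ t → dist (γ s) (γ t) = |s - t|)
    (r : ℝ → ℝ) (hr_smooth : ContDiff ℝ 1 r)
    (hr_nonneg : ∀ t, 0 ≤ t → 0 ≤ r t)
    (hr0 : r 0 = 0) (hr_lt : ∀ t, 0 < t → r t < t)
    (a b : ℝ) (ha : 0 ≤ a) (hab : a < b) :
    (∀ t ∈ Ioo a b, 1 ≤ deriv r t) ↔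
      (∀ t₁ t₂, t₁ ∈ Ioo a b → t₂ ∈ Ioo a b → t₁ < t₂ →
        closedBall (γ t₁) (r t₁) ⊆ closedBall (γ t₂) (r t₂)) := by
  rw [one_le_deriv_iff_monotoneOn_sub_id (hr_smooth.differentiable one_ne_zero)]
  have hball {t₁ t₂ : ℝ} (h₁ : t₁ ∈ Ioo a b) (hlt : t₁ < t₂) :=
    have hpos : 0 < t₁ := ha.trans_lt h₁.1
    closedBall_subset_closedBall_iff_of_ray hγ (r₂ := r t₂) (hr_nonneg t₁ hpos.le)
      (hr_lt t₁ hpos).le hlt.le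
  constructor
  · exact fun h t₁ t₂ h₁ h₂ hlt => (hball h₁ hlt).2 (h h₁ h₂ hlt.le)
  · intro h t₁ h₁ t₂ h₂ hle
    rcases hle.eq_or_lt with rfl | hlt
    · exact le_rfl
    · exact (hball h₁ hlt).1 (h t₁ t₂ h₁ h₂ hlt)
end

section
/- Let f : ℝᵐ → ℝⁿ be a harmonic map and u : ℝⁿ → ℝ a twice continuously differentiable function whose second derivative (Hessian) is positive definite at every point of ℝⁿ. If the total derivative of f at a point p ∈ ℝᵐ is nonzero, then Δ(u ∘ f)(p) > 0. -/
open Metric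

/-- Second-order chain rule: the second directional derivative of `u ∘ f` along `v`. -/
theorem fderiv_fderiv_comp_apply {E F G : Type*}
    [NormedAddCommGroup E] [NormedSpace ℝ E] [NormedAddCommGroup F] [NormedSpace ℝ F]
    [NormedAddCommGroup G] [NormedSpace ℝ G] {f : E → F} {u : F → G}
    (hf : ContDiff ℝ 2 f) (hu : ContDiff ℝ 2 u) (p v : E) :
    fderiv ℝ (fun y => fderiv ℝ (u ∘ f) y v) p v =
      fderiv ℝ (fderiv ℝ u) (f p) (fderiv ℝ f p v) (fderiv ℝ f p v) +
        fderiv ℝ u (f p) (fderiv ℝ (fun y => fderiv ℝ f y v) p v) := by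
  have hf1 : Differentiable ℝ f := hf.differentiable (by norm_num)
  have hu1 : Differentiable ℝ u := hu.differentiable (by norm_num)
  have hf2 : Differentiable ℝ (fderiv ℝ f) :=
    (hf.fderiv_right (m := 1) (by norm_num)).differentiable (by norm_num)
  have hu2 : Differentiable ℝ (fderiv ℝ u) :=
    (hu.fderiv_right (m := 1) (by norm_num)).differentiable (by norm_num)
  have hcomp : (fun y => fderiv ℝ (u ∘ f) y v) =
      fun y => fderiv ℝ u (f y) (fderiv ℝ f y v) := by
    funext y
    rw [fderiv_comp y (hu1 _) (hf1 y), ContinuousLinearMap.comp_apply]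
  have hc : HasFDerivAt (fun y => fderiv ℝ u (f y))
      ((fderiv ℝ (fderiv ℝ u) (f p)).comp (fderiv ℝ f p)) p :=
    (hu2 (f p)).hasFDerivAt.comp p (hf1 p).hasFDerivAt
  have hd : DifferentiableAt ℝ (fun y => fderiv ℝ f y v) p :=
    (hf2 p).clm_apply (differentiableAt_const v)
  rw [hcomp, (hc.clm_apply hd.hasFDerivAt).fderiv]
  simp [add_comm]

/-- If `f : ℝᵐ → ℝⁿ` is harmonic, `u : ℝⁿ → ℝ` is `C²` with everywhere positive
definite Hessian, and `df_p ≠ 0`, then `Δ(u ∘ f)(p) > 0`. -/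
theorem laplacian_comp_pos_of_hessian_posdef {m n : ℕ}
    (f : EuclideanSpace ℝ (Fin m) → EuclideanSpace ℝ (Fin n))
    (hf : IsHarmonicMap f)
    (u : EuclideanSpace ℝ (Fin n) → ℝ) (hu : ContDiff ℝ 2 u)
    (hu_posdef : ∀ (y : EuclideanSpace ℝ (Fin n)) (w : EuclideanSpace ℝ (Fin n)),
      w ≠ 0 → 0 < fderiv ℝ (fderiv ℝ u) y w w)
    (p : EuclideanSpace ℝ (Fin m)) (hdf : fderiv ℝ f p ≠ 0) :
    0 < ∑ i : Fin m,
      fderiv ℝ (fun y => fderiv ℝ (u ∘ f) y (EuclideanSpace.single i 1)) p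
        (EuclideanSpace.single i 1) := by
  have hchain := fun i => fderiv_fderiv_comp_apply hf.1 hu p (EuclideanSpace.single (i : Fin m) 1)
  simp only [hchain]
  rw [Finset.sum_add_distrib, ← map_sum, hf.2 p, map_zero, add_zero]
  have hne : ∃ i : Fin m, fderiv ℝ f p (EuclideanSpace.single i 1) ≠ 0 := by
    by_contra! h
    refine hdf (ContinuousLinearMap.coe_injective
      ((EuclideanSpace.basisFun (Fin m) ℝ).toBasis.ext fun i => ?_))
    simpa using h i
  obtain ⟨i, hi⟩ := hne
  refine Finset.sum_pos' (fun j _ => ?_) ⟨i, Finset.mem_univ i, hu_posdef _ _ hi⟩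
  by_cases hj : fderiv ℝ f p (EuclideanSpace.single j 1) = 0
  · simp [hj]
  · exact (hu_posdef _ _ hj).le
end

section
/- Define g : ℝ → ℝ by g(x) = log(x + 1) for x ≥ 0 and g(x) = 0 for x < 0, and let G = {(x, g(x)) : x ∈ ℝ} ⊆ ℝ² be its graph. Then the closure of the convex hull of G is the closed upper halfplane: closure(convexHull ℝ G) = {(x, y) ∈ ℝ² : y ≥ 0}. -/
open Metric Real

/-- If `f` vanishes on the negative reals and is `log (x + 1)` on the nonnegative reals, every point
of the open upper halfplane lies in the convex hull of the graph of `f`. -/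
theorem mem_convexHull_log_graph {f : ℝ → ℝ}
    (hf : ∀ x : ℝ, f x = if 0 ≤ x then Real.log (x + 1) else 0) (a : ℝ) {b : ℝ} (hb : 0 < b) :
    (a, b) ∈ convexHull ℝ {p : ℝ × ℝ | p.2 = f p.1} := by
  obtain ⟨s, hbs, has⟩ : ∃ s, b < s ∧ 2 * a < b * s := by
    refine ⟨b + 1 + 2 * |a| / b, by linarith [show 0 ≤ 2 * |a| / b by positivity], ?_⟩
    have h : b * (b + 1 + 2 * |a| / b) = b * (b + 1) + 2 * |a| := by field_simp
    rw [h]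
    nlinarith [le_abs_self a]
  have hs : 0 < s := hb.trans hbs
  have hlt : b / s < 1 := (div_lt_one hs).2 hbs
  have hexp : a < b / s * (exp s - 1) := by
    rw [div_mul_eq_mul_div, lt_div_iff₀ hs]
    nlinarith [mul_le_mul_of_nonneg_left (quadratic_le_exp_of_nonneg hs.le) hb.le]
  set z := (a - b / s * (exp s - 1)) / (1 - b / s) with hz
  have hzneg : z < 0 := div_neg_of_neg_of_pos (by linarith) (by linarith)
  have hright : (exp s - 1, s) ∈ {p : ℝ × ℝ | p.2 = f p.1} := by
    simp [hf, hs.le]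
  have hleft : (z, (0 : ℝ)) ∈ {p : ℝ × ℝ | p.2 = f p.1} := by
    simp [hf, not_le.2 hzneg]
  have hcomb := convex_convexHull ℝ {p : ℝ × ℝ | p.2 = f p.1} (subset_convexHull ℝ _ hright)
    (subset_convexHull ℝ _ hleft) (div_pos hb hs).le (sub_pos.2 hlt).le (add_sub_cancel _ _)
  convert hcomb using 1
  ext
  · simp [hz, mul_div_cancel₀ _ (sub_pos.2 hlt).ne']
  · simp [hs.ne']

/-- The closure of the convex hull of the graph of `g(x) = log(x+1)` for `x ≥ 0`,
`g(x) = 0` for `x < 0`, is the closed upper halfplane. -/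
theorem closure_convexHull_log_graph
    (g : ℝ → ℝ) (hg : ∀ x : ℝ, g x = if 0 ≤ x then Real.log (x + 1) else 0)
    (G : Set (ℝ × ℝ)) (hG : G = {p : ℝ × ℝ | p.2 = g p.1}) :
    closure (convexHull ℝ G) = {p : ℝ × ℝ | 0 ≤ p.2} := by
  subst hG
  apply Set.Subset.antisymm
  · refine closure_minimal (convexHull_min ?_ ?_) (isClosed_le continuous_const continuous_snd)
    · rintro ⟨x, y⟩ (rfl : y = g x)
      simp only [Set.mem_ofPred_eq, hg]
      split_ifs with hx
      · exact log_nonneg (by linarith)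
      · exact le_rfl
    · exact convex_halfSpace_ge (LinearMap.snd ℝ ℝ ℝ).isLinear 0
  · rintro ⟨a, b⟩ hb
    have hmem : (a, b) ∈ closure (Set.univ ×ˢ Set.Ioi (0 : ℝ) : Set (ℝ × ℝ)) := by
      rw [closure_prod_eq, closure_univ, closure_Ioi]
      exact ⟨Set.mem_univ a, hb⟩
    exact closure_mono (fun p hp => mem_convexHull_log_graph hg p.1 hp.2) hmem
end
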